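/- Let R be a rack. The complete lattice of subracks of R is distributive (i.e. Q₁ ⊓ (Q₂ ⊔ Q₃) = (Q₁ ⊓ Q₂) ⊔ (Q₁ ⊓ Q₃) for all subracks Q₁, Q₂, Q₃) if and only if ⟪a◃b⟫ = ⟪b⟫ for all a, b ∈ R (i.e. the corresponding quandle of R is the trivial quandle). -/

import Mathlib

open Quandles

/-- A subrack of a rack `R`: a subset closed under the action and its inverse. -/
def IsSubrack {R : Type*} [Rack R] (Q : Set R) : Prop :=
  ∀ a ∈ Q, ∀ b ∈ Q, a ◃ b ∈ Q ∧ (Rack.act' a).symm b ∈ Q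

/-- The subrack generated by a subset `S` of a rack: the intersection of all subracks
containing `S`. -/
def subrackGen {R : Type*} [Rack R] (S : Set R) : Set R :=
  ⋂₀ {Q : Set R | IsSubrack Q ∧ S ⊆ Q}

section

variable {R : Type*} [Rack R]

theorem isSubrack_subrackGen (S : Set R) : IsSubrack (subrackGen S) := fun _ ha _ hb =>
  ⟨fun Q hQ => (hQ.1 _ (ha Q hQ) _ (hb Q hQ)).1, fun Q hQ => (hQ.1 _ (ha Q hQ) _ (hb Q hQ)).2⟩

theorem subset_subrackGen (S : Set R) : S ⊆ subrackGen S := fun _ hx _ hQ => hQ.2 hx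

theorem IsSubrack.subrackGen_subset {S Q : Set R} (hQ : IsSubrack Q) (h : S ⊆ Q) :
    subrackGen S ⊆ Q := fun _ hx => hx Q ⟨hQ, h⟩

theorem IsSubrack.subrackGen_eq {Q : Set R} (hQ : IsSubrack Q) : subrackGen Q = Q :=
  (hQ.subrackGen_subset subset_rfl).antisymm (subset_subrackGen Q)

theorem IsSubrack.inter {P Q : Set R} (hP : IsSubrack P) (hQ : IsSubrack Q) :
    IsSubrack (P ∩ Q) := fun a ha b hb =>
  ⟨⟨(hP a ha.1 b hb.1).1, (hQ a ha.2 b hb.2).1⟩, ⟨(hP a ha.1 b hb.1).2, (hQ a ha.2 b hb.2).2⟩⟩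

theorem isSubrack_empty : IsSubrack (∅ : Set R) := fun _ ha => ha.elim

theorem mem_subrackGen_singleton (a : R) : a ∈ subrackGen {a} :=
  subset_subrackGen _ rfl

theorem IsSubrack.subrackGen_singleton_subset {Q : Set R} (hQ : IsSubrack Q) {a : R}
    (ha : a ∈ Q) : subrackGen {a} ⊆ Q :=
  hQ.subrackGen_subset (Set.singleton_subset_iff.2 ha)

theorem act'_act_of_act'_eq {a b : R} (h : Rack.act' a = Rack.act' b) :
    Rack.act' (a ◃ b) = Rack.act' b := by
  rw [Rack.ad_conj, h, mul_inv_cancel_right]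

theorem act'_symm_of_act'_eq {a b : R} (h : Rack.act' a = Rack.act' b) :
    Rack.act' ((Rack.act' a).symm b) = Rack.act' b := by
  have hb := Rack.ad_conj a ((Rack.act' a).symm b)
  rw [Rack.act'_symm_apply, Rack.act_invAct_eq, ← h, eq_mul_inv_iff_mul_eq] at hb
  rw [Rack.act'_symm_apply, ← h]
  exact (mul_left_cancel hb).symm

theorem subrackGen_act_eq_of_act'_eq {a b : R} (h : Rack.act' a = Rack.act' b) :
    subrackGen {a ◃ b} = subrackGen {b} := by
  apply Set.Subset.antisymm
  · apply (isSubrack_subrackGen _).subrackGen_singleton_subset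
    have hab : a ◃ b = b ◃ b := congrArg (fun e : R ≃ R => e b) h
    rw [hab]
    exact ((isSubrack_subrackGen _) b (mem_subrackGen_singleton b) b
      (mem_subrackGen_singleton b)).1
  · apply (isSubrack_subrackGen _).subrackGen_singleton_subset
    have hmem := ((isSubrack_subrackGen {a ◃ b}) _ (mem_subrackGen_singleton _) _
      (mem_subrackGen_singleton _)).2
    rwa [act'_act_of_act'_eq h, ← h, Rack.act'_symm_apply, Rack.invAct_act_eq] at hmem

/-- All elements of a one-generated subrack act in the same way and generate that subrack. -/
theorem act'_eq_and_subrackGen_eq_of_mem {a b : R} (h : b ∈ subrackGen {a}) :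
    Rack.act' b = Rack.act' a ∧ subrackGen {b} = subrackGen {a} := by
  have hQ : IsSubrack {x : R | Rack.act' x = Rack.act' a ∧ subrackGen {x} = subrackGen {a}} := by
    rintro x ⟨hx, -⟩ y ⟨hy, hy'⟩
    have hxy := hx.trans hy.symm
    refine ⟨⟨(act'_act_of_act'_eq hxy).trans hy,
      (subrackGen_act_eq_of_act'_eq hxy).trans hy'⟩, (act'_symm_of_act'_eq hxy).trans hy, ?_⟩
    have hgen := subrackGen_act_eq_of_act'_eq (hxy.trans (act'_symm_of_act'_eq hxy).symm)
    rw [Rack.act'_symm_apply, Rack.act_invAct_eq] at hgen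
    exact hgen.symm.trans hy'
  exact hQ.subrackGen_singleton_subset ⟨rfl, rfl⟩ h

theorem IsSubrack.union_of_subrackGen_act_eq
    (h : ∀ a b : R, subrackGen {a ◃ b} = subrackGen {b}) {P Q : Set R}
    (hP : IsSubrack P) (hQ : IsSubrack Q) : IsSubrack (P ∪ Q) := by
  have key : ∀ {T : Set R}, IsSubrack T → ∀ a, ∀ b ∈ T,
      a ◃ b ∈ T ∧ (Rack.act' a).symm b ∈ T := by
    intro T hT a b hb
    have hsub := hT.subrackGen_singleton_subset hb
    refine ⟨hsub (h a b ▸ mem_subrackGen_singleton _), hsub ?_⟩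
    have hgen := h a ((Rack.act' a).symm b)
    rw [Rack.act'_symm_apply, Rack.act_invAct_eq] at hgen
    rw [hgen]
    exact mem_subrackGen_singleton _
  rintro a - b (hb | hb)
  · exact (key hP a b hb).imp Or.inl Or.inl
  · exact (key hQ a b hb).imp Or.inr Or.inr

theorem subrackGen_act_eq_of_distrib
    (h : ∀ Q₁ Q₂ Q₃ : Set R, IsSubrack Q₁ → IsSubrack Q₂ → IsSubrack Q₃ →
      Q₁ ∩ subrackGen (Q₂ ∪ Q₃) = subrackGen ((Q₁ ∩ Q₂) ∪ (Q₁ ∩ Q₃))) (a b : R) :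
    subrackGen {a ◃ b} = subrackGen {b} := by
  have hmem : a ◃ b ∈ subrackGen {a ◃ b} ∩ subrackGen (subrackGen {a} ∪ subrackGen {b}) :=
    ⟨mem_subrackGen_singleton _, ((isSubrack_subrackGen _) a
      (subset_subrackGen _ (Or.inl (mem_subrackGen_singleton a))) b
      (subset_subrackGen _ (Or.inr (mem_subrackGen_singleton b)))).1⟩
  rw [h _ _ _ (isSubrack_subrackGen _) (isSubrack_subrackGen _) (isSubrack_subrackGen _)] at hmem
  obtain ⟨x, hx⟩ : ((subrackGen {a ◃ b} ∩ subrackGen {a}) ∪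
      (subrackGen {a ◃ b} ∩ subrackGen {b})).Nonempty := by
    by_contra hne
    rw [Set.not_nonempty_iff_eq_empty.1 hne, isSubrack_empty.subrackGen_eq] at hmem
    exact hmem
  rcases hx with ⟨hx, hx'⟩ | ⟨hx, hx'⟩
  · have hact : Rack.act' (a ◃ b) = Rack.act' a :=
      (act'_eq_and_subrackGen_eq_of_mem hx).1.symm.trans (act'_eq_and_subrackGen_eq_of_mem hx').1
    rw [Rack.ad_conj, mul_inv_eq_iff_eq_mul] at hact
    exact subrackGen_act_eq_of_act'_eq (mul_left_cancel hact).symm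
  · exact (act'_eq_and_subrackGen_eq_of_mem hx).2.symm.trans
      (act'_eq_and_subrackGen_eq_of_mem hx').2

end

/-- the lattice of subracks of `R` (inclusion order; meet is
intersection, join is the subrack generated by the union) is distributive iff
`⟪a ◃ b⟫ = ⟪b⟫` for all `a b : R`, i.e. the corresponding quandle of `R` is the
trivial quandle. -/
theorem stmt_13 {R : Type*} [Rack R] :
    (∀ Q₁ Q₂ Q₃ : Set R, IsSubrack Q₁ → IsSubrack Q₂ → IsSubrack Q₃ →
      Q₁ ∩ subrackGen (Q₂ ∪ Q₃) = subrackGen ((Q₁ ∩ Q₂) ∪ (Q₁ ∩ Q₃))) ↔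
    (∀ a b : R, subrackGen {a ◃ b} = subrackGen {b}) := by
  refine ⟨subrackGen_act_eq_of_distrib, fun h Q₁ Q₂ Q₃ h₁ h₂ h₃ => ?_⟩
  rw [(h₂.union_of_subrackGen_act_eq h h₃).subrackGen_eq,
    ((h₁.inter h₂).union_of_subrackGen_act_eq h (h₁.inter h₃)).subrackGen_eq,
    Set.inter_union_distrib_left]
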